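/- Let m ≥ 1, N > 2m, let n ≥ 1, let (e_{ij}) be a symmetric n × n matrix with entries in {0,1}, let p_{ij} ≥ 1, q_{ij} > 0, and let each Ψ_{ij} satisfy condition (K). Let (u_1, …, u_n) be a non-negative solution of the system (−Δ)^m u_i ≥ Σ_{j=1}^n e_{ij} (Ψ_{ij}(|·|) * u_j^{p_{ij}}) u_i^{q_{ij}} in ℝ^N, 1 ≤ i ≤ n. If there exist indices k, ℓ ∈ {1,…,n} (not necessarily distinct) with e_{kℓ} = e_{ℓk} = 1, p_{kℓ}, q_{kℓ}, p_{ℓk}, q_{ℓk} ≥ 1, and limsup_{r→∞} min{ r^{2N−(N−2m)(p_{kℓ}+q_{kℓ})} Ψ_{kℓ}(r), r^{2N−(N−2m)(p_{ℓk}+q_{ℓk})} Ψ_{ℓk}(r) } > 0, then u_k ≡ 0 or u_ℓ ≡ 0. -/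

import Mathlib

open MeasureTheory Filter Metric

/-- The Laplacian of `u : ℝ^N → ℝ`, defined via the second iterated Fréchet derivative. -/
noncomputable def lap {N : ℕ} (u : EuclideanSpace ℝ (Fin N) → ℝ) :
    EuclideanSpace ℝ (Fin N) → ℝ :=
  fun x => ∑ i : Fin N,
    iteratedFDeriv ℝ 2 u x ![EuclideanSpace.single i 1, EuclideanSpace.single i 1]

/-- `negLapPow m u = (-Δ)^m u`, the `m`-fold iterate of the negative Laplacian. -/
noncomputable def negLapPow {N : ℕ} (m : ℕ) (u : EuclideanSpace ℝ (Fin N) → ℝ) :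
    EuclideanSpace ℝ (Fin N) → ℝ :=
  (fun v => fun x => -(lap v x))^[m] u

/-- Condition (K) on the kernel `Ψ`. -/
structure CondK (N : ℕ) (Ψ : ℝ → ℝ) : Prop where
  pos : ∀ r : ℝ, 0 < r → 0 < Ψ r
  cont : ContinuousOn (fun x : EuclideanSpace ℝ (Fin N) => Ψ ‖x‖)
    {(0 : EuclideanSpace ℝ (Fin N))}ᶜ
  locInt : LocallyIntegrable (fun x : EuclideanSpace ℝ (Fin N) => Ψ ‖x‖) volume
  anti : AntitoneOn Ψ (Set.Ioi (0 : ℝ))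
  tendsto : Tendsto (fun r : ℝ => r ^ N * Ψ r) atTop atTop

section

open Topology
open scoped ContDiff

variable {N : ℕ}

lemma lap_apply (u : EuclideanSpace ℝ (Fin N) → ℝ) (x : EuclideanSpace ℝ (Fin N)) :
    lap u x = ∑ i : Fin N, fderiv ℝ (fderiv ℝ u) x (EuclideanSpace.single i 1)
      (EuclideanSpace.single i 1) := by
  simp [lap, iteratedFDeriv_two_apply]

lemma contDiff_partial {n k : WithTop ℕ∞} {u : EuclideanSpace ℝ (Fin N) → ℝ}
    (hu : ContDiff ℝ n u) (hk : k + 1 ≤ n) (v : EuclideanSpace ℝ (Fin N)) :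
    ContDiff ℝ k fun x => fderiv ℝ u x v :=
  (hu.fderiv_right hk).clm_apply contDiff_const

lemma lap_eq_sum_partial {u : EuclideanSpace ℝ (Fin N) → ℝ} (hu : ContDiff ℝ 2 u)
    (x : EuclideanSpace ℝ (Fin N)) :
    lap u x = ∑ i : Fin N, fderiv ℝ (fun y => fderiv ℝ u y (EuclideanSpace.single i 1)) x
      (EuclideanSpace.single i 1) := by
  rw [lap_apply]
  refine Finset.sum_congr rfl fun i _ => ?_
  have h : DifferentiableAt ℝ (fderiv ℝ u) x :=
    ((hu.fderiv_right (m := 1) (by norm_num)).differentiable (by norm_num)) x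
  rw [fderiv_clm_apply h (differentiableAt_const _)]
  simp

lemma ContDiff.lap {n k : WithTop ℕ∞} {u : EuclideanSpace ℝ (Fin N) → ℝ}
    (hu : ContDiff ℝ n u) (hk : k + 2 ≤ n) : ContDiff ℝ k (lap u) := by
  have h2 : (2 : WithTop ℕ∞) ≤ n := le_trans (by simp) hk
  have : _root_.lap u = fun x => ∑ i : Fin N,
      fderiv ℝ (fun y => fderiv ℝ u y (EuclideanSpace.single i 1)) x
      (EuclideanSpace.single i 1) := funext fun x => lap_eq_sum_partial (hu.of_le h2) x
  rw [this]
  refine ContDiff.sum fun i _ => ?_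
  refine contDiff_partial (n := k + 1) (contDiff_partial hu ?_ _) le_rfl _
  rwa [add_assoc, one_add_one_eq_two]

lemma integral_partial_mul {f g : EuclideanSpace ℝ (Fin N) → ℝ} (hf : ContDiff ℝ 1 f)
    (hg : ContDiff ℝ 1 g) (hc : HasCompactSupport g) (v : EuclideanSpace ℝ (Fin N)) :
    ∫ x, fderiv ℝ f x v * g x = - ∫ x, f x * fderiv ℝ g x v := by
  have hf' : Continuous fun x => fderiv ℝ f x v :=
    (contDiff_partial (k := 0) hf (by simp) v).continuous
  have hg' : Continuous fun x => fderiv ℝ g x v :=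
    (contDiff_partial (k := 0) hg (by simp) v).continuous
  have hc' : HasCompactSupport fun x => fderiv ℝ g x v := hc.fderiv_apply ℝ v
  have := integral_mul_fderiv_eq_neg_fderiv_mul_of_integrable (μ := volume) (f := f) (g := g)
    (v := v) ((hf'.mul hg.continuous).integrable_of_hasCompactSupport hc.mul_left)
    ((hf.continuous.mul hg').integrable_of_hasCompactSupport hc'.mul_left)
    ((hf.continuous.mul hg.continuous).integrable_of_hasCompactSupport hc.mul_left)
    (fun x _ => hf.differentiable (by norm_num) x) (fun x _ => hg.differentiable (by norm_num) x)
  rw [this, neg_neg]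

lemma integral_lap_mul {f g : EuclideanSpace ℝ (Fin N) → ℝ} (hf : ContDiff ℝ 2 f)
    (hg : ContDiff ℝ 2 g) (hc : HasCompactSupport g) :
    ∫ x, lap f x * g x = ∫ x, f x * lap g x := by
  have h12 : (1 : WithTop ℕ∞) + 1 ≤ 2 := by norm_num
  have hf1 := fun v => contDiff_partial (k := 1) hf h12 v
  have hg1 := fun v => contDiff_partial (k := 1) hg h12 v
  have hf2 := fun v => (contDiff_partial (k := 0) (hf1 v) (by simp) v).continuous
  have hg2 := fun v => (contDiff_partial (k := 0) (hg1 v) (by simp) v).continuous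
  have hcv : ∀ v, HasCompactSupport fun x => fderiv ℝ g x v := fun v => hc.fderiv_apply ℝ v
  have hcv2 : ∀ v, HasCompactSupport fun x => fderiv ℝ (fun y => fderiv ℝ g y v) x v :=
    fun v => (hcv v).fderiv_apply ℝ v
  simp_rw [lap_eq_sum_partial hf, lap_eq_sum_partial hg, Finset.sum_mul, Finset.mul_sum]
  rw [integral_finsetSum, integral_finsetSum]
  · refine Finset.sum_congr rfl fun i _ => ?_
    rw [integral_partial_mul (hf1 _) (hg.of_le (by norm_num)) hc,
      integral_partial_mul (hf.of_le (by norm_num)) (hg1 _) (hcv _), neg_neg]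
  · exact fun i _ => (hf.continuous.mul (hg2 _)).integrable_of_hasCompactSupport (hcv2 _).mul_left
  · exact fun i _ => ((hf2 _).mul hg.continuous).integrable_of_hasCompactSupport hc.mul_left

lemma negLapPow_succ (m : ℕ) (u : EuclideanSpace ℝ (Fin N) → ℝ) :
    negLapPow (m + 1) u = negLapPow m fun x => -lap u x := rfl

lemma negLapPow_succ' (m : ℕ) (u : EuclideanSpace ℝ (Fin N) → ℝ) :
    negLapPow (m + 1) u = fun x => -lap (negLapPow m u) x := by
  simp only [negLapPow, Function.iterate_succ_apply']

lemma contDiff_negLapPow (m : ℕ) {n k : WithTop ℕ∞} {u : EuclideanSpace ℝ (Fin N) → ℝ}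
    (hu : ContDiff ℝ n u) (hk : k + 2 * m ≤ n) : ContDiff ℝ k (negLapPow m u) := by
  induction m generalizing u n with
  | zero => simpa [negLapPow] using hu.of_le (by simpa using hk)
  | succ m ih =>
    rw [negLapPow_succ]
    refine ih (n := k + 2 * m) ?_ le_rfl
    refine (hu.lap (k := k + 2 * m) (le_trans (le_of_eq ?_) hk)).neg
    push_cast
    ring

lemma HasCompactSupport.negLapPow (m : ℕ) {g : EuclideanSpace ℝ (Fin N) → ℝ}
    (hc : HasCompactSupport g) : HasCompactSupport (negLapPow m g) := by
  induction m with
  | zero => exact hc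
  | succ m ih =>
    rw [negLapPow_succ']
    have h1 : HasCompactSupport (fderiv ℝ (fderiv ℝ (_root_.negLapPow m g))) :=
      (ih.fderiv ℝ).fderiv ℝ
    simp_rw [lap_apply]
    exact h1.comp_left
      (g := fun L : EuclideanSpace ℝ (Fin N) →L[ℝ] EuclideanSpace ℝ (Fin N) →L[ℝ] ℝ =>
      -∑ i : Fin N, L (EuclideanSpace.single i 1) (EuclideanSpace.single i 1)) (by simp)

lemma integral_negLapPow_mul (m : ℕ) {f g : EuclideanSpace ℝ (Fin N) → ℝ}
    (hf : ContDiff ℝ (2 * m) f) (hg : ContDiff ℝ ∞ g) (hc : HasCompactSupport g) :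
    ∫ x, negLapPow m f x * g x = ∫ x, f x * negLapPow m g x := by
  induction m generalizing f with
  | zero => rfl
  | succ m ih =>
    have hf2 : ContDiff ℝ (2 * m) fun x => -lap f x :=
      (hf.lap (k := 2 * m) (le_of_eq (by push_cast; ring))).neg
    have hg2 : ContDiff ℝ 2 (negLapPow m g) :=
      contDiff_negLapPow m (contDiff_infty.1 hg (2 + 2 * m)) (by push_cast; rfl)
    rw [negLapPow_succ, ih hf2, negLapPow_succ']
    simp only [neg_mul, mul_neg, integral_neg]
    rw [integral_lap_mul (hf.of_le _) hg2 (hc.negLapPow m)]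
    push_cast
    rw [mul_add]
    simp

/-- The bounded radial variable `(1 + b‖x‖²)^(-1/2)`. -/
noncomputable def radVar (b : ℝ) (x : EuclideanSpace ℝ (Fin N)) : ℝ :=
  (√(1 + b * ‖x‖ ^ 2))⁻¹

/-- The operator in one variable to which `-Δ` reduces on functions of `radVar`. -/
noncomputable def radialOp (N : ℕ) (H : ℝ → ℝ) : ℝ → ℝ := fun s =>
  -(s ^ 4 - s ^ 6) * deriv (deriv H) s + (((N : ℝ) - 3) * s ^ 3 + 3 * s ^ 5) * deriv H s

lemma contDiff_deriv {H : ℝ → ℝ} (hH : ContDiff ℝ ∞ H) : ContDiff ℝ ∞ (deriv H) :=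
  (contDiff_infty_iff_deriv.1 hH).2

lemma contDiff_radialOp {H : ℝ → ℝ} (hH : ContDiff ℝ ∞ H) (N : ℕ) :
    ContDiff ℝ ∞ (radialOp N H) := by
  have h1 := contDiff_deriv hH
  have h2 := contDiff_deriv h1
  unfold radialOp
  fun_prop

lemma radVar_pos {b : ℝ} (hb : 0 ≤ b) (x : EuclideanSpace ℝ (Fin N)) : 0 < radVar b x := by
  unfold radVar
  positivity

lemma radVar_sq {b : ℝ} (hb : 0 ≤ b) (x : EuclideanSpace ℝ (Fin N)) :
    radVar b x ^ 2 * (1 + b * ‖x‖ ^ 2) = 1 := by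
  unfold radVar
  have h : 0 < 1 + b * ‖x‖ ^ 2 := by positivity
  rw [inv_pow, Real.sq_sqrt h.le, inv_mul_cancel₀ h.ne']

lemma radVar_le_one {b : ℝ} (hb : 0 ≤ b) (x : EuclideanSpace ℝ (Fin N)) : radVar b x ≤ 1 := by
  unfold radVar
  refine inv_le_one_of_one_le₀ (Real.one_le_sqrt.2 ?_)
  have : 0 ≤ b * ‖x‖ ^ 2 := by positivity
  linarith

lemma contDiff_radVar {b : ℝ} (hb : 0 ≤ b) :
    ContDiff ℝ ∞ (radVar b : EuclideanSpace ℝ (Fin N) → ℝ) := by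
  have h : ContDiff ℝ ∞ fun x : EuclideanSpace ℝ (Fin N) => 1 + b * ‖x‖ ^ 2 :=
    contDiff_const.add (contDiff_const.mul (contDiff_norm_sq ℝ))
  have h0 : ∀ x : EuclideanSpace ℝ (Fin N), 1 + b * ‖x‖ ^ 2 ≠ 0 := fun x => by positivity
  exact (h.sqrt h0).inv fun x => by positivity

lemma hasFDerivAt_radVar {b : ℝ} (hb : 0 ≤ b) (x : EuclideanSpace ℝ (Fin N)) :
    HasFDerivAt (radVar b) ((-b * radVar b x ^ 3) • innerSL ℝ x) x := by
  have h0 : 0 < 1 + b * ‖x‖ ^ 2 := by positivity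
  have h1 : HasFDerivAt (fun y : EuclideanSpace ℝ (Fin N) => 1 + b * ‖y‖ ^ 2)
      (b • (2 • innerSL ℝ x)) x :=
    ((hasStrictFDerivAt_norm_sq x).hasFDerivAt.const_mul b).const_add 1
  have h2 := ((Real.hasDerivAt_sqrt h0.ne').inv (by positivity)).comp_hasFDerivAt x h1
  refine h2.congr_fderiv ?_
  ext v
  simp only [radVar, smul_apply, smul_eq_mul, nsmul_eq_mul]
  have hs : 0 < √(1 + b * ‖x‖ ^ 2) := by positivity
  field_simp
  push_cast
  ring

lemma fderiv_comp_radVar {b : ℝ} (hb : 0 ≤ b) {H : ℝ → ℝ} (hH : Differentiable ℝ H)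
    (x v : EuclideanSpace ℝ (Fin N)) :
    fderiv ℝ (fun y => H (radVar b y)) x v
      = -b * radVar b x ^ 3 * deriv H (radVar b x) * inner ℝ x v := by
  have := (hH (radVar b x)).hasDerivAt.comp_hasFDerivAt x (hasFDerivAt_radVar hb x)
  rw [show (fun y => H (radVar b y)) = H ∘ radVar b from rfl, this.fderiv]
  simp
  ring

lemma contDiff_comp_radVar {b : ℝ} (hb : 0 ≤ b) {H : ℝ → ℝ} (hH : ContDiff ℝ ∞ H) (n : ℕ) :
    ContDiff ℝ n fun x : EuclideanSpace ℝ (Fin N) => H (radVar b x) :=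
  contDiff_infty.1 (hH.comp (contDiff_radVar hb)) n

lemma neg_lap_comp_radVar {b : ℝ} (hb : 0 ≤ b) {H : ℝ → ℝ} (hH : ContDiff ℝ ∞ H)
    (x : EuclideanSpace ℝ (Fin N)) :
    -lap (fun y => H (radVar b y)) x = b * radialOp N H (radVar b x) := by
  have hH1 := contDiff_deriv hH
  have hd : Differentiable ℝ H := hH.differentiable (by simp)
  have hd1 : Differentiable ℝ (deriv H) := hH1.differentiable (by simp)
  rw [lap_eq_sum_partial (contDiff_comp_radVar hb hH 2)]
  set G : ℝ → ℝ := fun s => -b * s ^ 3 * deriv H s with hG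
  have hGd : Differentiable ℝ G := by fun_prop
  have hG' : ∀ s, deriv G s = -b * (3 * s ^ 2 * deriv H s + s ^ 3 * deriv (deriv H) s) := by
    intro s
    have := (((hasDerivAt_pow 3 s).const_mul (-b)).mul (hd1 s).hasDerivAt).deriv
    simp only [hG]
    refine Eq.trans this ?_
    norm_num
    ring
  have key : ∀ v : EuclideanSpace ℝ (Fin N),
      fderiv ℝ (fun y => fderiv ℝ (fun y => H (radVar b y)) y v) x v
        = -b * radVar b x ^ 3 * deriv G (radVar b x) * inner ℝ x v ^ 2
          + G (radVar b x) * ‖v‖ ^ 2 := by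
    intro v
    simp_rw [fderiv_comp_radVar hb hd]
    have h1 : DifferentiableAt ℝ (fun y => G (radVar b y)) x :=
      (hGd _).comp x (hasFDerivAt_radVar hb x).differentiableAt
    have h2 : DifferentiableAt ℝ (fun y : EuclideanSpace ℝ (Fin N) => inner ℝ y v) x :=
      DifferentiableAt.inner ℝ differentiableAt_fun_id (differentiableAt_const _)
    have h3 := fderiv_fun_mul h1 h2
    rw [show (fun y => -b * radVar b y ^ 3 * deriv H (radVar b y) * inner ℝ y v)
      = fun y => G (radVar b y) * inner ℝ y v from rfl, h3]
    have h4 : fderiv ℝ (fun y : EuclideanSpace ℝ (Fin N) => inner ℝ y v) x v = ‖v‖ ^ 2 := by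
      rw [fderiv_inner_apply ℝ differentiableAt_fun_id (differentiableAt_const _)]
      simp
    simp only [add_apply, smul_apply, smul_eq_mul]
    rw [h4, fderiv_comp_radVar hb hGd]
    ring
  simp_rw [key, hG', hG]
  have hsq := radVar_sq hb x
  have hn : ∑ i : Fin N, (inner ℝ x (EuclideanSpace.single i (1 : ℝ))) ^ 2 = ‖x‖ ^ 2 := by
    rw [EuclideanSpace.real_norm_sq_eq]
    exact Finset.sum_congr rfl fun i _ => by simp [EuclideanSpace.inner_single_right]
  rw [Finset.sum_add_distrib, ← Finset.mul_sum, hn]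
  simp only [PiLp.norm_single, norm_one, one_pow, mul_one, Finset.sum_const,
    Finset.card_univ, Fintype.card_fin, nsmul_eq_mul, radialOp]
  generalize radVar b x = s at *
  generalize deriv H s = A
  generalize deriv (deriv H) s = B
  have h5 : b * (s ^ 2 * ‖x‖ ^ 2) = 1 - s ^ 2 := by linarith
  linear_combination (-b * s * (3 * s ^ 2 * A + s ^ 3 * B)) * h5

lemma contDiff_radialOp_iterate {H : ℝ → ℝ} (hH : ContDiff ℝ ∞ H) (N m : ℕ) :
    ContDiff ℝ ∞ ((radialOp N)^[m] H) := by
  induction m with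
  | zero => exact hH
  | succ m ih =>
    rw [Function.iterate_succ_apply']
    exact contDiff_radialOp ih N

lemma lap_const_mul {f : EuclideanSpace ℝ (Fin N) → ℝ} (hf : ContDiff ℝ 2 f) (c : ℝ)
    (x : EuclideanSpace ℝ (Fin N)) : lap (fun y => c * f y) x = c * lap f x := by
  have h := iteratedFDeriv_const_smul_apply (𝕜 := ℝ) (i := 2) (a := c) (x := x) hf.contDiffAt
  simp only [lap, Finset.mul_sum]
  refine Finset.sum_congr rfl fun i _ => ?_
  rw [show (fun y => c * f y) = c • f from rfl, h]
  simp

lemma negLapPow_comp_radVar {b : ℝ} (hb : 0 ≤ b) {H : ℝ → ℝ} (hH : ContDiff ℝ ∞ H) (m : ℕ) :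
    negLapPow m (fun y : EuclideanSpace ℝ (Fin N) => H (radVar b y))
      = fun x => b ^ m * (radialOp N)^[m] H (radVar b x) := by
  induction m with
  | zero => simp [negLapPow]
  | succ m ih =>
    have h := contDiff_radialOp_iterate hH N m
    ext x
    rw [negLapPow_succ', ih]
    beta_reduce
    rw [lap_const_mul (contDiff_comp_radVar hb h 2), ← mul_neg, neg_lap_comp_radVar hb h,
      Function.iterate_succ_apply']
    ring

lemma radialOp_congr {f g : ℝ → ℝ} {s : ℝ} (h : f =ᶠ[𝓝 s] g) (N : ℕ) :
    radialOp N f =ᶠ[𝓝 s] radialOp N g := by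
  filter_upwards [h.deriv, h.deriv.deriv] with t h1 h2
  simp only [radialOp, h1, h2]

lemma radialOp_iterate_congr {f g : ℝ → ℝ} {s : ℝ} (h : f =ᶠ[𝓝 s] g) (N m : ℕ) :
    (radialOp N)^[m] f s = (radialOp N)^[m] g s := by
  suffices (radialOp N)^[m] f =ᶠ[𝓝 s] (radialOp N)^[m] g from this.eq_of_nhds
  induction m with
  | zero => exact h
  | succ m ih =>
    simp only [Function.iterate_succ_apply']
    exact radialOp_congr ih N

lemma deriv_linear_comb {f g : ℝ → ℝ} (hf : Differentiable ℝ f) (hg : Differentiable ℝ g)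
    (α β : ℝ) :
    deriv (fun s => α * f s + β * g s) = fun s => α * deriv f s + β * deriv g s := by
  ext s
  exact (((hf s).hasDerivAt.const_mul α).add ((hg s).hasDerivAt.const_mul β)).deriv

lemma radialOp_linear_comb {f g : ℝ → ℝ} (hf : ContDiff ℝ ∞ f) (hg : ContDiff ℝ ∞ g)
    (N : ℕ) (α β : ℝ) :
    radialOp N (fun s => α * f s + β * g s)
      = fun s => α * radialOp N f s + β * radialOp N g s := by
  ext s
  simp only [radialOp]
  rw [deriv_linear_comb (hf.differentiable (by simp)) (hg.differentiable (by simp)),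
    deriv_linear_comb ((contDiff_deriv hf).differentiable (by simp))
      ((contDiff_deriv hg).differentiable (by simp))]
  ring

lemma radialOp_iterate_linear_comb {f g : ℝ → ℝ} (hf : ContDiff ℝ ∞ f) (hg : ContDiff ℝ ∞ g)
    (N m : ℕ) (α β : ℝ) :
    (radialOp N)^[m] (fun s => α * f s + β * g s)
      = fun s => α * (radialOp N)^[m] f s + β * (radialOp N)^[m] g s := by
  induction m with
  | zero => rfl
  | succ m ih =>
    simp only [Function.iterate_succ_apply', ih]
    exact radialOp_linear_comb (contDiff_radialOp_iterate hf N m)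
      (contDiff_radialOp_iterate hg N m) N α β

lemma radialOp_pow (N : ℕ) {a : ℕ} (ha : 2 ≤ a) :
    radialOp N (fun s => s ^ a) = fun s =>
      ((a : ℝ) * (N - 2 - a)) * s ^ (a + 2) + ((a : ℝ) * (a + 2)) * s ^ (a + 4) := by
  obtain ⟨k, rfl⟩ := Nat.exists_eq_add_of_le' ha
  have h1 : deriv (fun s : ℝ => s ^ (k + 2)) = fun s : ℝ => ((k : ℝ) + 2) * s ^ (k + 1) := by
    ext s
    simp
  have h2 : deriv (fun s : ℝ => ((k : ℝ) + 2) * s ^ (k + 1))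
      = fun s : ℝ => ((k : ℝ) + 2) * (((k : ℝ) + 1) * s ^ k) := by
    ext s
    rw [deriv_const_mul _ (differentiableAt_pow _)]
    simp
  ext s
  simp only [radialOp, h1, h2]
  push_cast
  ring

lemma radialOp_iterate_pow (N m : ℕ) {a : ℕ} (ha : 2 ≤ a) :
    ∃ Q : ℝ → ℝ, Continuous Q ∧
      Q 0 = ∏ i ∈ Finset.range m, (((a : ℝ) + 2 * i) * (N - 2 - a - 2 * i)) ∧
      ∀ s, (radialOp N)^[m] (fun s => s ^ a) s = s ^ (a + 2 * m) * Q s := by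
  induction m generalizing a with
  | zero => exact ⟨fun _ => 1, continuous_const, by simp, by simp⟩
  | succ m ih =>
    obtain ⟨Q₁, hc₁, h0₁, hQ₁⟩ := ih (a := a + 2) (by omega)
    obtain ⟨Q₂, hc₂, h0₂, hQ₂⟩ := ih (a := a + 4) (by omega)
    refine ⟨fun s => ((a : ℝ) * (N - 2 - a)) * Q₁ s + ((a : ℝ) * (a + 2)) * (s ^ 2 * Q₂ s),
      by fun_prop, ?_, fun s => ?_⟩
    · beta_reduce
      rw [h0₁, Finset.prod_range_succ']
      simp only [Nat.cast_add, Nat.cast_ofNat, Nat.cast_one, Nat.cast_zero]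
      have : ∀ i : ℕ, ((a : ℝ) + 2 * (i + 1)) * (N - 2 - a - 2 * (i + 1))
          = (a + 2 + 2 * i) * (N - 2 - (a + 2) - 2 * i) := fun i => by ring
      simp only [this]
      ring
    · rw [Function.iterate_succ_apply, radialOp_pow N ha, radialOp_iterate_linear_comb
        (f := fun s => s ^ (a + 2)) (g := fun s => s ^ (a + 4)) (by fun_prop) (by fun_prop)]
      beta_reduce
      rw [hQ₁, hQ₂]
      ring

lemma radialOp_iterate_rescaled_bound (N m : ℕ) {K : ℝ → ℝ} (hK : ContDiff ℝ ∞ K) :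
    ∃ C : ℝ, 0 ≤ C ∧ ∀ ε : ℝ, 0 < ε → ε ≤ 1 → ∀ s : ℝ, 0 ≤ s → s ≤ ε →
      |(radialOp N)^[m] (fun s => K (ε⁻¹ * s)) s| ≤ C * ε ^ (2 * m) := by
  induction m generalizing K with
  | zero =>
    obtain ⟨C, hC⟩ := (isCompact_Icc (a := (0 : ℝ)) (b := 1)).exists_bound_of_continuousOn
      hK.continuous.continuousOn
    refine ⟨C, (norm_nonneg _).trans (hC 0 (by simp)), fun ε hε _ s hs hsε => ?_⟩
    simpa using hC (ε⁻¹ * s) ⟨by positivity, by rwa [inv_mul_le_one₀ hε]⟩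
  | succ m ih =>
    have hK1 := contDiff_deriv hK
    have hK2 := contDiff_deriv hK1
    set K₁ : ℝ → ℝ := fun t => -t ^ 4 * deriv (deriv K) t + ((N : ℝ) - 3) * t ^ 3 * deriv K t
      with hK₁
    set K₂ : ℝ → ℝ := fun t => t ^ 6 * deriv (deriv K) t + 3 * t ^ 5 * deriv K t with hK₂
    have hs₁ : ContDiff ℝ ∞ K₁ := by fun_prop
    have hs₂ : ContDiff ℝ ∞ K₂ := by fun_prop
    obtain ⟨C₁, hC₁, h₁⟩ := ih hs₁
    obtain ⟨C₂, hC₂, h₂⟩ := ih hs₂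
    refine ⟨C₁ + C₂, by positivity, fun ε hε hε1 s hs hsε => ?_⟩
    have hop : radialOp N (fun s => K (ε⁻¹ * s))
        = fun s => ε ^ 2 * K₁ (ε⁻¹ * s) + ε ^ 4 * K₂ (ε⁻¹ * s) := by
      have hd1 : deriv (fun s => K (ε⁻¹ * s)) = fun s => ε⁻¹ * deriv K (ε⁻¹ * s) := by
        ext s
        simpa using deriv_comp_mul_left ε⁻¹ K s
      have hd2 : deriv (fun s => ε⁻¹ * deriv K (ε⁻¹ * s))
          = fun s => ε⁻¹ * (ε⁻¹ * deriv (deriv K) (ε⁻¹ * s)) := by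
        ext s
        rw [deriv_const_mul_field]
        simpa using Or.inl (deriv_comp_mul_left ε⁻¹ (deriv K) s)
      ext s
      simp only [radialOp, hd1, hd2, hK₁, hK₂]
      field_simp
      ring
    rw [Function.iterate_succ_apply, hop, radialOp_iterate_linear_comb (by fun_prop) (by fun_prop)]
    refine (abs_add_le _ _).trans ?_
    rw [abs_mul, abs_mul, abs_of_nonneg (by positivity : 0 ≤ ε ^ 2),
      abs_of_nonneg (by positivity : 0 ≤ ε ^ 4)]
    have e4 : ε ^ 4 ≤ ε ^ 2 := pow_le_pow_of_le_one hε.le hε1 (by norm_num)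
    calc _ ≤ ε ^ 2 * (C₁ * ε ^ (2 * m)) + ε ^ 2 * (C₂ * ε ^ (2 * m)) := by
          gcongr
          · exact h₁ ε hε hε1 s hs hsε
          · exact h₂ ε hε hε1 s hs hsε
      _ = _ := by ring

lemma exists_radial_profile (N m : ℕ) (hm : 1 ≤ m) (hN : 2 * m < N) :
    ∃ σ C δ : ℝ, 0 < σ ∧ σ < 1 ∧ 0 < C ∧ 0 < δ ∧ ∀ ε : ℝ, 0 < ε → ε < σ → ∃ H : ℝ → ℝ,
      ContDiff ℝ ∞ H ∧ (∀ s, 0 ≤ s → 0 ≤ H s) ∧ (∀ s, σ ≤ s → δ ≤ H s) ∧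
      (∀ s, s ≤ ε / 2 → H s = 0) ∧ (∀ s, s < ε / 2 → (radialOp N)^[m] H s = 0) ∧
      (∀ s, 0 ≤ s → s ≤ σ → (radialOp N)^[m] H s ≤ C * ε ^ (N + 1)) ∧
      (∀ s, σ ≤ s → s ≤ 1 → (radialOp N)^[m] H s ≤ C) := by
  set a : ℕ := N - 2 * m + 1 with ha
  have haN : a + 2 * m = N + 1 := by omega
  have haR : (a : ℝ) = N + 1 - 2 * m := by
    have : ((a + 2 * m : ℕ) : ℝ) = ((N + 1 : ℕ) : ℝ) := by rw [haN]
    push_cast at this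
    linarith
  obtain ⟨Q, hQc, hQ0, hQ⟩ := radialOp_iterate_pow N m (a := a) (by omega)
  have hneg : Q 0 < 0 := by
    obtain ⟨k, rfl⟩ := Nat.exists_eq_add_of_le' hm
    rw [hQ0, Finset.prod_range_succ]
    have ha0 : (0 : ℝ) < a := by exact_mod_cast (by omega : 0 < a)
    push_cast at haR
    refine mul_neg_of_pos_of_neg (Finset.prod_pos fun i hi => ?_) ?_
    · have : (i : ℝ) + 1 ≤ k := by exact_mod_cast Finset.mem_range.1 hi
      exact mul_pos (by positivity) (by rw [haR]; linarith)
    · exact mul_neg_of_pos_of_neg (by positivity) (by rw [haR]; linarith)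
  obtain ⟨ρ, hρ, hρQ⟩ := Metric.eventually_nhds_iff.1
    (hQc.continuousAt.eventually_lt_const hneg)
  set σ : ℝ := min (ρ / 2) (1 / 2) with hσ
  have hσ0 : 0 < σ := by positivity
  have hσ1 : σ < 1 := (min_le_right _ _).trans_lt (by norm_num)
  have hσQ : ∀ s, 0 ≤ s → s ≤ σ → Q s ≤ 0 := fun s h0 h1 => (hρQ (by
    rw [Real.dist_eq, sub_zero, abs_of_nonneg h0]
    exact (h1.trans (min_le_left _ _)).trans_lt (by linarith))).le
  obtain ⟨C₁, hC₁⟩ := (isCompact_Icc (a := (0 : ℝ)) (b := 1)).exists_bound_of_continuousOn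
    (f := fun s => s ^ (a + 2 * m) * Q s) (by fun_prop)
  have hχ : ContDiff ℝ ∞ Real.smoothTransition := Real.smoothTransition.contDiff
  set K : ℝ → ℝ := fun t => t ^ a * Real.smoothTransition (2 * t - 1) with hK
  have hKs : ContDiff ℝ ∞ K :=
    (contDiff_id.pow a).mul (hχ.comp ((contDiff_const.mul contDiff_id).sub contDiff_const))
  obtain ⟨C₂, hC₂, hb⟩ := radialOp_iterate_rescaled_bound N m hKs
  have hC₁0 : 0 ≤ C₁ := (norm_nonneg _).trans (hC₁ 0 (by simp))
  refine ⟨σ, C₁ + C₂ + 1, σ ^ a, hσ0, hσ1, by positivity, by positivity, fun ε hε hεσ => ?_⟩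
  set H : ℝ → ℝ := fun s => ε ^ a * K (ε⁻¹ * s) with hH
  have hKε : ContDiff ℝ ∞ fun s => K (ε⁻¹ * s) := hKs.comp (contDiff_const.mul contDiff_id)
  have hHs : ContDiff ℝ ∞ H := contDiff_const.mul hKε
  have hHeq : ∀ s, H s = s ^ a * Real.smoothTransition (2 * (ε⁻¹ * s) - 1) := fun s => by
    simp only [hH, hK, mul_pow]
    rw [← mul_assoc, ← mul_assoc, ← mul_pow, mul_inv_cancel₀ hε.ne', one_pow, one_mul]
  have hH1 : ∀ s, ε ≤ s → H s = s ^ a := fun s hs => by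
    have h1 : 1 ≤ ε⁻¹ * s := by
      rw [← inv_mul_cancel₀ hε.ne']
      gcongr
    rw [hHeq, Real.smoothTransition.one_of_one_le (by linarith), mul_one]
  have hH0 : ∀ s, s ≤ ε / 2 → H s = 0 := fun s hs => by
    have h1 : ε⁻¹ * s ≤ 1 / 2 := by
      calc ε⁻¹ * s ≤ ε⁻¹ * (ε / 2) := by gcongr
        _ = 1 / 2 := by field_simp
    rw [hHeq, Real.smoothTransition.zero_of_nonpos (by linarith), mul_zero]
  have hEpow : ∀ s, ε < s → (radialOp N)^[m] H s = s ^ (a + 2 * m) * Q s := fun s hs => by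
    rw [← hQ]
    refine radialOp_iterate_congr ?_ N m
    filter_upwards [lt_mem_nhds hs] with t ht using hH1 t ht.le
  refine ⟨H, hHs, fun s hs => ?_, fun s hs => ?_, hH0, fun s hs => ?_, fun s hs0 hs => ?_,
    fun s hs hs1 => ?_⟩
  · rw [hHeq]
    exact mul_nonneg (by positivity) (Real.smoothTransition.nonneg _)
  · rw [hH1 s (hεσ.le.trans hs)]
    gcongr
  · have hz : (radialOp N)^[m] (fun s => 0 * H s + 0 * H s) s = 0 := by
      rw [radialOp_iterate_linear_comb hHs hHs]
      simp
    rw [← hz]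
    refine radialOp_iterate_congr ?_ N m
    filter_upwards [gt_mem_nhds hs] with t ht
    simp [hH0 t ht.le]
  · rcases le_or_gt s ε with h | h
    · have h1 : (radialOp N)^[m] H s = ε ^ a * (radialOp N)^[m] (fun s => K (ε⁻¹ * s)) s := by
        have := congrFun (radialOp_iterate_linear_comb hKε hKε N m (ε ^ a) 0) s
        simpa using this
      rw [h1]
      calc _ ≤ ε ^ a * (C₂ * ε ^ (2 * m)) := by
            gcongr
            exact (le_abs_self _).trans (hb ε hε (by linarith) s hs0 h)
        _ = C₂ * ε ^ (N + 1) := by rw [← haN]; ring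
        _ ≤ _ := by gcongr; linarith
    · rw [hEpow s h]
      exact (mul_nonpos_of_nonneg_of_nonpos (by positivity) (hσQ s hs0 hs)).trans (by positivity)
  · rw [hEpow s (hεσ.trans_le hs)]
    refine ((le_abs_self _).trans (hC₁ s ⟨by linarith, hs1⟩)).trans (by linarith)

lemma le_radVar_iff {b s : ℝ} (hb : 0 ≤ b) (hs : 0 ≤ s) (x : EuclideanSpace ℝ (Fin N)) :
    s ≤ radVar b x ↔ s ^ 2 * (1 + b * ‖x‖ ^ 2) ≤ 1 := by
  have h : 0 < 1 + b * ‖x‖ ^ 2 := by positivity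
  rw [← pow_le_pow_iff_left₀ hs (radVar_pos hb x).le two_ne_zero, ← mul_le_mul_iff_left₀ h,
    radVar_sq hb]

lemma setIntegral_negLapPow_le (N m : ℕ) (hm : 1 ≤ m) (hN : 2 * m < N) :
    ∃ C : ℝ, 0 < C ∧ ∀ u : EuclideanSpace ℝ (Fin N) → ℝ, ContDiff ℝ (2 * m) u →
      (∀ x, 0 ≤ u x) → (∀ x, 0 ≤ negLapPow m u x) →
      (∃ A : ℝ, ∀ᶠ S : ℝ in atTop, ∫ x in closedBall 0 S, u x ≤ A * S ^ N) →
      ∀ R : ℝ, 0 < R → ∫ x in closedBall 0 R, negLapPow m u x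
        ≤ C * ((R ^ (2 * m))⁻¹ * ∫ x in closedBall 0 R, u x) := by
  obtain ⟨σ, C, δ, hσ0, hσ1, hC, hδ, hprof⟩ := exists_radial_profile N m hm hN
  have hσ2 : 0 < σ⁻¹ ^ 2 - 1 := by
    have : 1 < σ⁻¹ ^ 2 := one_lt_pow₀ ((one_lt_inv₀ hσ0).2 hσ1) (by norm_num)
    linarith
  refine ⟨δ⁻¹ * ((σ⁻¹ ^ 2 - 1) ^ m * C), by positivity, ?_⟩
  rintro u hu hu0 hf0 ⟨A, hA⟩ R hR
  set f := negLapPow m u with hf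
  have hfc : Continuous f := (contDiff_negLapPow m (k := 0) hu (by simp)).continuous
  have huc : Continuous u := hu.continuous
  set b : ℝ := (σ⁻¹ ^ 2 - 1) / R ^ 2 with hb
  have hb0 : 0 < b := by positivity
  have hbR : σ ^ 2 * (1 + b * R ^ 2) = 1 := by
    rw [hb]
    field_simp
    ring
  have hball : ∀ x : EuclideanSpace ℝ (Fin N), σ ≤ radVar b x ↔ x ∈ closedBall 0 R := fun x => by
    calc σ ≤ radVar b x ↔ σ ^ 2 * (1 + b * ‖x‖ ^ 2) ≤ σ ^ 2 * (1 + b * R ^ 2) := by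
          rw [hbR]
          exact le_radVar_iff hb0.le hσ0.le x
      _ ↔ x ∈ closedBall 0 R := by
          rw [mem_closedBall_zero_iff, mul_le_mul_iff_right₀ (by positivity), add_le_add_iff_left,
            mul_le_mul_iff_right₀ hb0, pow_le_pow_iff_left₀ (norm_nonneg x) hR.le two_ne_zero]
  have hint : ∀ {g : EuclideanSpace ℝ (Fin N) → ℝ}, Continuous g → ∀ S : ℝ,
      IntegrableOn g (closedBall 0 S) := fun hg S =>
    hg.continuousOn.integrableOn_compact (isCompact_closedBall 0 S)
  set D : ℝ := (2 / √b) ^ (N + 1) with hD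
  have hsb : 0 < √b := Real.sqrt_pos.2 hb0
  have hev : ∀ᶠ S : ℝ in atTop, δ * ∫ x in closedBall 0 R, f x
      ≤ b ^ m * (C * ∫ x in closedBall 0 R, u x) + b ^ m * C * D * A * S⁻¹ := by
    filter_upwards [hA, eventually_gt_atTop 0, eventually_gt_atTop (2 / (√b * σ))]
      with S hSA hS0 hS
    set ε : ℝ := 2 / (S * √b) with hε
    have hε0 : 0 < ε := by positivity
    have hεσ : ε < σ := by
      rw [div_lt_iff₀ (by positivity)] at hS
      rw [hε, div_lt_iff₀ (by positivity)]
      linarith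
    obtain ⟨H, hHs, hH0, hHδ, hHz, hEz, hE1, hE2⟩ := hprof ε hε0 hεσ
    have hεball : ∀ x : EuclideanSpace ℝ (Fin N), x ∉ closedBall 0 S → radVar b x < ε / 2 := by
      intro x hx
      contrapose! hx
      rw [le_radVar_iff hb0.le (by positivity)] at hx
      have h1 : (ε / 2) ^ 2 * b = (S ^ 2)⁻¹ := by
        rw [hε]
        field_simp
        rw [Real.sq_sqrt hb0.le]
      have h2 : (S ^ 2)⁻¹ * ‖x‖ ^ 2 ≤ 1 := by
        rw [← h1]
        nlinarith [sq_nonneg (ε / 2)]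
      rw [inv_mul_le_one₀ (by positivity), pow_le_pow_iff_left₀ (norm_nonneg x) hS0.le
        (by norm_num)] at h2
      simpa using h2
    set φ : EuclideanSpace ℝ (Fin N) → ℝ := fun x => H (radVar b x) with hφ
    have hφs : ContDiff ℝ ∞ φ := hHs.comp (contDiff_radVar hb0.le)
    have hφc : HasCompactSupport φ := HasCompactSupport.intro (isCompact_closedBall 0 S)
      fun x hx => hHz _ (hεball x hx).le
    have hφ0 : ∀ x, 0 ≤ φ x := fun x => hH0 _ (radVar_pos hb0.le x).le
    have hpar := integral_negLapPow_mul m hu hφs hφc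
    rw [← hf, hφ, negLapPow_comp_radVar hb0.le hHs] at hpar
    set g : EuclideanSpace ℝ (Fin N) → ℝ := fun x => (radialOp N)^[m] H (radVar b x) with hg
    have hgc : Continuous g :=
      (contDiff_radialOp_iterate hHs N m).continuous.comp (contDiff_radVar hb0.le).continuous
    have hgS : HasCompactSupport g := HasCompactSupport.intro (isCompact_closedBall 0 S)
      fun x hx => hEz _ (hεball x hx)
    calc δ * ∫ x in closedBall 0 R, f x = ∫ x in closedBall 0 R, f x * δ := by
          rw [integral_mul_const, mul_comm]
      _ ≤ ∫ x in closedBall 0 R, f x * φ x := by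
          refine setIntegral_mono_on (hint (by fun_prop) R)
            (hint (hfc.mul hφs.continuous) R) measurableSet_closedBall fun x hx => ?_
          exact mul_le_mul_of_nonneg_left (hHδ _ ((hball x).2 hx)) (hf0 x)
      _ ≤ ∫ x, f x * φ x := by
          refine setIntegral_le_integral
            ((hfc.mul hφs.continuous).integrable_of_hasCompactSupport hφc.mul_left) ?_
          exact Eventually.of_forall fun x => mul_nonneg (hf0 x) (hφ0 x)
      _ = b ^ m * ∫ x, u x * g x := by
          rw [hpar, ← integral_const_mul]
          exact integral_congr_ae (Eventually.of_forall fun x => by simp only [hg]; ring)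
      _ ≤ b ^ m * ∫ x, ((closedBall 0 R).indicator (fun x => C * u x) x
            + (closedBall 0 S).indicator (fun x => C * ε ^ (N + 1) * u x) x) := by
          refine mul_le_mul_of_nonneg_left (integral_mono
            ((huc.mul hgc).integrable_of_hasCompactSupport hgS.mul_left) ?_ fun x => ?_)
            (by positivity)
          · exact ((hint (by fun_prop) R).integrable_indicator measurableSet_closedBall).add
              ((hint (by fun_prop) S).integrable_indicator measurableSet_closedBall)
          · have hx0 := (radVar_pos hb0.le x).le
            by_cases hxR : x ∈ closedBall 0 R
            · have h1 : g x ≤ C := hE2 _ ((hball x).2 hxR) (radVar_le_one hb0.le x)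
              have h2 : 0 ≤ (closedBall (0 : EuclideanSpace ℝ (Fin N)) S).indicator
                  (fun x => C * ε ^ (N + 1) * u x) x :=
                Set.indicator_nonneg (fun y _ => mul_nonneg (by positivity) (hu0 y)) x
              simp only [Set.indicator_of_mem hxR]
              nlinarith [hu0 x]
            · have h1 : g x ≤ C * ε ^ (N + 1) :=
                hE1 _ hx0 (le_of_lt (not_le.1 (mt (hball x).1 hxR)))
              simp only [Set.indicator_of_notMem hxR, zero_add]
              by_cases hxS : x ∈ closedBall 0 S
              · simp only [Set.indicator_of_mem hxS]
                nlinarith [hu0 x]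
              · have : g x = 0 := hEz _ (hεball x hxS)
                simp [Set.indicator_of_notMem hxS, this]
      _ = b ^ m * (C * ∫ x in closedBall 0 R, u x)
            + b ^ m * (C * ε ^ (N + 1) * ∫ x in closedBall 0 S, u x) := by
          rw [integral_add ((hint (by fun_prop) R).integrable_indicator measurableSet_closedBall)
              ((hint (by fun_prop) S).integrable_indicator measurableSet_closedBall),
            integral_indicator measurableSet_closedBall,
            integral_indicator measurableSet_closedBall, integral_const_mul, integral_const_mul]
          ring
      _ ≤ b ^ m * (C * ∫ x in closedBall 0 R, u x)
            + b ^ m * (C * ε ^ (N + 1) * (A * S ^ N)) := by gcongr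
      _ = _ := by
          have : ε ^ (N + 1) * S ^ N = D * S⁻¹ := by
            rw [hε, hD, div_pow, div_pow, mul_pow]
            field_simp
            ring
          linear_combination b ^ m * C * A * this
  have hlim : Tendsto (fun S : ℝ => b ^ m * (C * ∫ x in closedBall 0 R, u x)
      + b ^ m * C * D * A * S⁻¹) atTop (𝓝 (b ^ m * (C * ∫ x in closedBall 0 R, u x))) := by
    simpa using tendsto_const_nhds.add (tendsto_inv_atTop_zero.const_mul (b ^ m * C * D * A))
  have hfin := ge_of_tendsto hlim hev
  have hbm : b ^ m = (σ⁻¹ ^ 2 - 1) ^ m * (R ^ (2 * m))⁻¹ := by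
    rw [hb, div_pow, ← pow_mul, div_eq_mul_inv]
  rw [← le_div_iff₀' hδ] at hfin
  refine hfin.trans (le_of_eq ?_)
  rw [hbm]
  ring

lemma Continuous.integrableOn_closedBall {f : EuclideanSpace ℝ (Fin N) → ℝ} (hf : Continuous f)
    (x : EuclideanSpace ℝ (Fin N)) (r : ℝ) : IntegrableOn f (closedBall x r) :=
  hf.continuousOn.integrableOn_compact (isCompact_closedBall x r)

lemma volume_real_closedBall {r : ℝ} (hr : 0 ≤ r) :
    volume.real (closedBall (0 : EuclideanSpace ℝ (Fin N)) r)
      = r ^ N * volume.real (closedBall (0 : EuclideanSpace ℝ (Fin N)) 1) := by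
  simp only [measureReal_def]
  rw [Measure.addHaar_closedBall' _ _ hr, ENNReal.toReal_mul,
    ENNReal.toReal_ofReal (by positivity), finrank_euclideanSpace_fin]

lemma exists_setIntegral_closedBall_le {Ψ : ℝ → ℝ} (hK : CondK N Ψ) {p : ℝ} (hp : 1 ≤ p)
    {u : EuclideanSpace ℝ (Fin N) → ℝ} (hu : Continuous u) (hu0 : ∀ x, 0 ≤ u x)
    (hint : IntegrableOn (fun y : EuclideanSpace ℝ (Fin N) => u y ^ p * Ψ (‖y‖ / 2))
      {y | 1 < ‖y‖}) :
    ∃ A : ℝ, ∀ᶠ S : ℝ in atTop, ∫ x in closedBall 0 S, u x ≤ A * S ^ N := by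
  set κ := volume.real (closedBall (0 : EuclideanSpace ℝ (Fin N)) 1)
  set J := ∫ y in {y : EuclideanSpace ℝ (Fin N) | 1 < ‖y‖}, u y ^ p * Ψ (‖y‖ / 2) with hJ
  set M := ∫ x in closedBall 0 1, u x with hM
  have hms : MeasurableSet {y : EuclideanSpace ℝ (Fin N) | 1 < ‖y‖} :=
    measurableSet_lt measurable_const measurable_norm
  have hM0 : 0 ≤ M := setIntegral_nonneg measurableSet_closedBall fun x _ => hu0 x
  have hJ0 : ∀ y ∈ {y : EuclideanSpace ℝ (Fin N) | 1 < ‖y‖}, 0 ≤ u y ^ p * Ψ (‖y‖ / 2) :=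
    fun y hy => mul_nonneg (Real.rpow_nonneg (hu0 y) _)
      (hK.pos _ (by have : 1 < ‖y‖ := hy; linarith)).le
  have htend : Tendsto (fun S : ℝ => S / 2) atTop atTop :=
    tendsto_id.atTop_div_const (by norm_num)
  refine ⟨κ + M + J, ?_⟩
  filter_upwards [(hK.tendsto.comp htend).eventually_ge_atTop 1, eventually_ge_atTop 1]
    with S hS hS1
  simp only [Function.comp_apply] at hS
  have hi1 : Integrable ((closedBall (0 : EuclideanSpace ℝ (Fin N)) 1).indicator u) :=
    (hu.integrableOn_closedBall 0 1).integrable_indicator measurableSet_closedBall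
  have hi2 := hint.integrable_indicator hms
  have hi3 := hi2.const_mul (S ^ N)
  have hi4 : Integrable ((closedBall (0 : EuclideanSpace ℝ (Fin N)) S).indicator
      fun _ => (1 : ℝ)) :=
    (continuous_const.integrableOn_closedBall 0 S).integrable_indicator measurableSet_closedBall
  calc ∫ x in closedBall 0 S, u x
      = ∫ x, (closedBall 0 S).indicator u x :=
        (integral_indicator measurableSet_closedBall).symm
    _ ≤ ∫ x, ((closedBall 0 S).indicator (fun _ => (1 : ℝ)) x + (closedBall 0 1).indicator u x
          + S ^ N * {y : EuclideanSpace ℝ (Fin N) | 1 < ‖y‖}.indicator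
            (fun y => u y ^ p * Ψ (‖y‖ / 2)) x) := by
        refine integral_mono ((hu.integrableOn_closedBall 0 S).integrable_indicator
          measurableSet_closedBall) ((hi4.add hi1).add hi3) fun x => ?_
        have h1 : 0 ≤ (closedBall (0 : EuclideanSpace ℝ (Fin N)) 1).indicator u x :=
          Set.indicator_nonneg (fun y _ => hu0 y) x
        have h2 := Set.indicator_nonneg hJ0 x
        have h2' : 0 ≤ S ^ N * {y : EuclideanSpace ℝ (Fin N) | 1 < ‖y‖}.indicator
            (fun y => u y ^ p * Ψ (‖y‖ / 2)) x := by positivity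
        by_cases hxS : x ∈ closedBall 0 S
        · simp only [Set.indicator_of_mem hxS]
          by_cases hx1 : 1 < ‖x‖
          · have hx1' : x ∈ {y : EuclideanSpace ℝ (Fin N) | 1 < ‖y‖} := hx1
            rw [Set.indicator_of_mem hx1'] at h2 ⊢
            have hxS' : ‖x‖ ≤ S := by simpa using hxS
            have h3 : Ψ (S / 2) ≤ Ψ (‖x‖ / 2) :=
              hK.anti (Set.mem_Ioi.2 (by linarith)) (Set.mem_Ioi.2 (by linarith)) (by linarith)
            have hpS : 0 < Ψ (S / 2) := hK.pos _ (by linarith)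
            have h4 : 1 ≤ S ^ N * Ψ (‖x‖ / 2) := by
              refine hS.trans ?_
              gcongr
              linarith
            have h5 : u x ≤ 1 + u x ^ p := by
              have h0 := Real.rpow_nonneg (hu0 x) p
              rcases le_or_gt (u x) 1 with h | h
              · linarith
              · linarith [Real.self_le_rpow_of_one_le h.le hp]
            have h6 : u x ^ p ≤ S ^ N * (u x ^ p * Ψ (‖x‖ / 2)) := by
              nlinarith [Real.rpow_nonneg (hu0 x) p]
            linarith
          · have : x ∈ closedBall (0 : EuclideanSpace ℝ (Fin N)) 1 := by simpa using hx1
            rw [Set.indicator_of_mem this]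
            linarith
        · simp only [Set.indicator_of_notMem hxS]
          linarith
    _ = S ^ N * κ + M + S ^ N * J := by
        have hi41 : Integrable (fun x => (closedBall (0 : EuclideanSpace ℝ (Fin N)) S).indicator
            (fun _ => (1 : ℝ)) x + (closedBall 0 1).indicator u x) := hi4.add hi1
        rw [integral_add hi41 hi3, integral_add hi4 hi1, integral_const_mul,
          integral_indicator measurableSet_closedBall, integral_indicator measurableSet_closedBall,
          integral_indicator hms, setIntegral_const, volume_real_closedBall (by linarith)]
        simp [hM, hJ, κ]
    _ ≤ _ := by
        have : 1 ≤ S ^ N := one_le_pow₀ hS1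
        nlinarith

lemma aestronglyMeasurable_kernel {Ψ : ℝ → ℝ} (hK : CondK N Ψ)
    (x : EuclideanSpace ℝ (Fin N)) :
    AEStronglyMeasurable (fun y : EuclideanSpace ℝ (Fin N) => Ψ ‖y - x‖) volume :=
  hK.locInt.aestronglyMeasurable.comp_measurePreserving (measurePreserving_sub_right volume x)

lemma integrable_rpow_mul_kernel {Ψ : ℝ → ℝ} (hK : CondK N Ψ) {p : ℝ} (hp : 1 ≤ p)
    {v : EuclideanSpace ℝ (Fin N) → ℝ} (hv : Continuous v) (hv0 : ∀ x, 0 ≤ v x)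
    (hint : IntegrableOn (fun y : EuclideanSpace ℝ (Fin N) => v y ^ p * Ψ (‖y‖ / 2))
      {y | 1 < ‖y‖}) (x : EuclideanSpace ℝ (Fin N)) :
    Integrable fun y => v y ^ p * Ψ ‖y - x‖ := by
  have hvp : Continuous fun y => v y ^ p :=
    hv.rpow_const fun _ => Or.inr (by linarith)
  rw [← integrableOn_univ, ← Set.union_compl_self (closedBall x (‖x‖ + 1))]
  refine IntegrableOn.union ?_ ?_
  · have h1 : IntegrableOn (fun y : EuclideanSpace ℝ (Fin N) => Ψ ‖y - x‖)
        (closedBall x (‖x‖ + 1)) := by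
      have h := ((measurePreserving_sub_right (volume : Measure (EuclideanSpace ℝ (Fin N)))
        x).integrableOn_comp_preimage (MeasurableEquiv.subRight x).measurableEmbedding).2
        (hK.locInt.integrableOn_isCompact (isCompact_closedBall 0 (‖x‖ + 1)))
      have hset : (fun y => y - x) ⁻¹' closedBall 0 (‖x‖ + 1) = closedBall x (‖x‖ + 1) := by
        ext y
        simp [dist_eq_norm]
      rwa [hset] at h
    exact h1.continuousOn_mul hvp.continuousOn (isCompact_closedBall _ _)
  · have hfar : ∀ y ∈ (closedBall x (‖x‖ + 1))ᶜ, 1 < ‖y‖ ∧ ‖y‖ / 2 ≤ ‖y - x‖ := by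
      intro y hy
      have h1 : ‖x‖ + 1 < ‖y - x‖ := by simpa [dist_eq_norm] using hy
      have h2 : ‖y - x‖ ≤ ‖y‖ + ‖x‖ := norm_sub_le y x
      have h3 : ‖y‖ ≤ ‖y - x‖ + ‖x‖ := by simpa using norm_add_le (y - x) x
      constructor <;> linarith
    refine Integrable.mono' (hint.mono_set fun y hy => (hfar y hy).1)
      (hvp.aestronglyMeasurable.mul (aestronglyMeasurable_kernel hK x)).restrict ?_
    filter_upwards [ae_restrict_mem measurableSet_closedBall.compl] with y hy
    obtain ⟨h1, h2⟩ := hfar y hy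
    have h3 : 0 < Ψ ‖y - x‖ := hK.pos _ (by linarith)
    have h4 := Real.rpow_nonneg (hv0 y) p
    rw [Real.norm_of_nonneg (by positivity)]
    gcongr
    exact hK.anti (Set.mem_Ioi.2 (by linarith)) (Set.mem_Ioi.2 (by linarith)) h2

lemma ae_rpow_mul_kernel_nonneg [NeZero N] {Ψ : ℝ → ℝ} (hK : CondK N Ψ) (p : ℝ)
    {v : EuclideanSpace ℝ (Fin N) → ℝ} (hv0 : ∀ x, 0 ≤ v x) (x : EuclideanSpace ℝ (Fin N)) :
    0 ≤ᵐ[volume] fun y => v y ^ p * Ψ ‖y - x‖ := by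
  filter_upwards [compl_mem_ae_iff.2 (measure_singleton x)] with y hy
  have : y ≠ x := hy
  exact mul_nonneg (Real.rpow_nonneg (hv0 y) p) (hK.pos _ (norm_pos_iff.2 (sub_ne_zero.2 this))).le

lemma kernel_mul_setIntegral_le [NeZero N] {Ψ : ℝ → ℝ} (hK : CondK N Ψ) {p : ℝ} (hp : 1 ≤ p)
    {v : EuclideanSpace ℝ (Fin N) → ℝ} (hv : Continuous v) (hv0 : ∀ x, 0 ≤ v x)
    (hint : IntegrableOn (fun y : EuclideanSpace ℝ (Fin N) => v y ^ p * Ψ (‖y‖ / 2))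
      {y | 1 < ‖y‖}) {x : EuclideanSpace ℝ (Fin N)} {r : ℝ} (hx : x ∈ closedBall 0 r)
    (hr : 0 < r) :
    Ψ (2 * r) * ∫ y in closedBall 0 r, v y ^ p ≤ ∫ y, v y ^ p * Ψ ‖y - x‖ := by
  have hvp : Continuous fun y => v y ^ p :=
    hv.rpow_const fun _ => Or.inr (by linarith)
  have hi := integrable_rpow_mul_kernel hK hp hv hv0 hint x
  rw [← integral_const_mul]
  refine le_trans ?_ (setIntegral_le_integral (s := closedBall 0 r) hi
    (ae_rpow_mul_kernel_nonneg hK p hv0 x))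
  refine setIntegral_mono_on_ae ((hvp.integrableOn_closedBall 0 r).const_mul _) hi.integrableOn
    measurableSet_closedBall ?_
  filter_upwards [compl_mem_ae_iff.2 (measure_singleton x)] with y hy hyr
  have hyx : y ≠ x := hy
  have h1 : 0 < ‖y - x‖ := norm_pos_iff.2 (sub_ne_zero.2 hyx)
  have h2 : ‖y - x‖ ≤ 2 * r := by
    have := norm_sub_le y x
    have hx' : ‖x‖ ≤ r := by simpa using hx
    have hy' : ‖y‖ ≤ r := by simpa using hyr
    linarith
  rw [mul_comm]
  exact mul_le_mul_of_nonneg_left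
    (hK.anti (Set.mem_Ioi.2 h1) (Set.mem_Ioi.2 (by linarith)) h2) (Real.rpow_nonneg (hv0 y) p)

lemma mul_div_rpow_le_setIntegral_rpow {w : EuclideanSpace ℝ (Fin N) → ℝ} (hw : Continuous w)
    (hw0 : ∀ x, 0 ≤ w x) {q M : ℝ} (hq : 1 ≤ q) (hM : 0 < M)
    {s : Set (EuclideanSpace ℝ (Fin N))} (hs : MeasurableSet s) (hb : Bornology.IsBounded s)
    (hsM : volume.real s ≤ M) :
    M * ((∫ x in s, w x) / M) ^ q ≤ ∫ x in s, w x ^ q := by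
  set a := (∫ x in s, w x) / M with ha
  have haM : ∫ x in s, w x = a * M := by
    rw [ha]
    field_simp
  have hwq : Continuous fun x => w x ^ q := hw.rpow_const fun _ => Or.inr (by linarith)
  obtain ⟨r, hr⟩ := hb.subset_closedBall 0
  have ha0 : 0 ≤ a := div_nonneg (setIntegral_nonneg hs fun x _ => hw0 x) hM.le
  rcases ha0.eq_or_lt with h0 | h0
  · rw [← h0, Real.zero_rpow (by linarith), mul_zero]
    exact setIntegral_nonneg hs fun x _ => Real.rpow_nonneg (hw0 x) q
  · have hfin : volume s ≠ ⊤ := hb.measure_lt_top.ne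
    have haq : 0 < a ^ q := Real.rpow_pos_of_pos h0 q
    have key : ∀ x ∈ s, a ^ q * (1 - q) + a ^ q * (q / a) * w x ≤ w x ^ q := fun x _ => by
      have h1 : -1 ≤ w x / a - 1 := by
        have : 0 ≤ w x / a := div_nonneg (hw0 x) h0.le
        linarith
      have h2 := one_add_mul_self_le_rpow_one_add h1 hq
      rw [add_sub_cancel, Real.div_rpow (hw0 x) h0.le, le_div_iff₀ haq] at h2
      refine le_trans (le_of_eq ?_) h2
      field_simp
      ring
    have hi1 : IntegrableOn w s := (hw.integrableOn_closedBall 0 r).mono_set hr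
    have hi2 : IntegrableOn (fun _ => a ^ q * (1 - q)) s :=
      integrableOn_const hfin
    have h := setIntegral_mono_on (hi2.add (hi1.const_mul (a ^ q * (q / a))))
      ((hwq.integrableOn_closedBall 0 r).mono_set hr) hs key
    simp only [Pi.add_apply] at h
    rw [integral_add hi2 (hi1.const_mul _), setIntegral_const, integral_const_mul, haM,
      smul_eq_mul] at h
    refine le_trans ?_ h
    have h3 : a ^ q * (q / a) * (a * M) = a ^ q * q * M := by field_simp
    rw [h3]
    have h4 : 0 ≤ a ^ q * (q - 1) * (M - volume.real s) :=
      mul_nonneg (mul_nonneg haq.le (by linarith)) (by linarith)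
    linarith

lemma setIntegral_closedBall_pos {f : EuclideanSpace ℝ (Fin N) → ℝ} (hf : Continuous f)
    (hf0 : ∀ x, 0 ≤ f x) {x : EuclideanSpace ℝ (Fin N)} (hx : 0 < f x) {r : ℝ} (hr : ‖x‖ < r) :
    0 < ∫ y in closedBall 0 r, f y := by
  rw [setIntegral_pos_iff_support_of_nonneg_ae (Eventually.of_forall hf0)
    (hf.integrableOn_closedBall 0 r)]
  have ho : IsOpen ({y | 0 < f y} ∩ ball 0 r) :=
    (isOpen_lt continuous_const hf).inter isOpen_ball
  refine (ho.measure_pos volume ⟨x, hx, by simpa using hr⟩).trans_le (measure_mono ?_)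
  rintro y ⟨hy, hyr⟩
  exact ⟨(ne_of_gt hy : f y ≠ 0), ball_subset_closedBall hyr⟩

lemma mul_div_pow_mul_rpow {r w V : ℝ} (hr : 0 < r) (hw : 0 < w) (hV : 0 ≤ V) (p : ℝ) :
    r ^ N * w * (V / (r ^ N * w)) ^ p
      = V ^ p * (r ^ ((N : ℝ) * (1 - p)) * w ^ (1 - p)) := by
  have hrN : 0 < r ^ N := by positivity
  rw [Real.div_rpow hV (by positivity), Real.mul_rpow hrN.le hw.le, Real.rpow_sub hw,
    mul_sub, Real.rpow_sub hr, Real.rpow_mul hr.le, Real.rpow_mul hr.le]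
  simp only [Real.rpow_one, Real.rpow_natCast]
  have := Real.rpow_pos_of_pos hrN p
  have := Real.rpow_pos_of_pos hw p
  field_simp

lemma mul_inv_pow_rpow {r V : ℝ} (hr : 0 < r) (hV : 0 ≤ V) (k : ℕ) (p : ℝ) :
    (V * (r ^ k)⁻¹) ^ p = V ^ p * r ^ (-((k : ℝ) * p)) := by
  rw [Real.mul_rpow hV (by positivity), Real.inv_rpow (by positivity), Real.rpow_neg hr.le,
    Real.rpow_mul hr.le, Real.rpow_natCast]

lemma exists_interaction_lower_bound [NeZero N] {Ψ : ℝ → ℝ} (hK : CondK N Ψ) {p q : ℝ}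
    (hp : 1 ≤ p) (hq : 1 ≤ q) {u v f : EuclideanSpace ℝ (Fin N) → ℝ} (hu : Continuous u)
    (hv : Continuous v) (hf : Continuous f) (hu0 : ∀ x, 0 ≤ u x) (hv0 : ∀ x, 0 ≤ v x)
    (hint : IntegrableOn (fun y : EuclideanSpace ℝ (Fin N) => v y ^ p * Ψ (‖y‖ / 2))
      {y | 1 < ‖y‖})
    (hle : ∀ x, (∫ y, v y ^ p * Ψ ‖y - x‖) * u x ^ q ≤ f x) (m : ℕ) {c : ℝ} (hc : 0 < c) :
    ∃ κ, 0 < κ ∧ ∀ r, 0 < r → ∀ T, T ≤ r →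
      c ≤ (2 * r) ^ (2 * (N : ℝ) - ((N : ℝ) - 2 * m) * (p + q)) * Ψ (2 * r) →
      κ * ((∫ x in closedBall 0 r, v x) * (r ^ (2 * m))⁻¹) ^ p
        * (((∫ x in closedBall 0 r, u x) - ∫ x in closedBall 0 T, u x) * (r ^ (2 * m))⁻¹) ^ q
      ≤ (∫ x in closedBall 0 r, f x) - ∫ x in closedBall 0 T, f x := by
  set w := volume.real (closedBall (0 : EuclideanSpace ℝ (Fin N)) 1) with hw_def
  have hw : 0 < w :=
    ENNReal.toReal_pos (measure_closedBall_pos volume 0 one_pos).ne'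
      measure_closedBall_lt_top.ne
  set θ := 2 * (N : ℝ) - ((N : ℝ) - 2 * m) * (p + q) with hθ
  refine ⟨c * 2 ^ (-θ) * w ^ (1 - p) * w ^ (1 - q), by positivity, fun r hr T hT hcr => ?_⟩
  have hsub : closedBall (0 : EuclideanSpace ℝ (Fin N)) T ⊆ closedBall 0 r :=
    closedBall_subset_closedBall hT
  set s := closedBall (0 : EuclideanSpace ℝ (Fin N)) r \ closedBall 0 T
  have hs : MeasurableSet s := measurableSet_closedBall.diff measurableSet_closedBall
  have hsr : s ⊆ closedBall 0 r := Set.sdiff_subset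
  have hdiff : ∀ g : EuclideanSpace ℝ (Fin N) → ℝ, Continuous g →
      (∫ x in closedBall 0 r, g x) - ∫ x in closedBall 0 T, g x = ∫ x in s, g x := fun g hg =>
    (setIntegral_sdiff measurableSet_closedBall (hg.integrableOn_closedBall 0 r) hsub).symm
  rw [hdiff u hu, hdiff f hf]
  set V := ∫ x in closedBall 0 r, v x with hV
  set W := ∫ x in s, u x with hW
  have hV0 : 0 ≤ V := setIntegral_nonneg measurableSet_closedBall fun x _ => hv0 x
  have hW0 : 0 ≤ W := setIntegral_nonneg hs fun x _ => hu0 x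
  have hM : 0 < r ^ N * w := by positivity
  have hΨ : 0 < Ψ (2 * r) := hK.pos _ (by linarith)
  have huq : Continuous fun x => u x ^ q := hu.rpow_const fun _ => Or.inr (by linarith)
  have h1 : Ψ (2 * r) * (∫ y in closedBall 0 r, v y ^ p) * ∫ x in s, u x ^ q
      ≤ ∫ x in s, f x := by
    rw [← integral_const_mul]
    refine setIntegral_mono_on (((huq.integrableOn_closedBall 0 r).mono_set hsr).const_mul _)
      ((hf.integrableOn_closedBall 0 r).mono_set hsr) hs fun x hx => le_trans ?_ (hle x)
    exact mul_le_mul_of_nonneg_right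
      (kernel_mul_setIntegral_le hK hp hv hv0 hint (hsr hx) hr) (Real.rpow_nonneg (hu0 x) q)
  have h2 : r ^ N * w * (V / (r ^ N * w)) ^ p ≤ ∫ y in closedBall 0 r, v y ^ p :=
    mul_div_rpow_le_setIntegral_rpow hv hv0 hp hM measurableSet_closedBall isBounded_closedBall
      (volume_real_closedBall hr.le).le
  have h3 : r ^ N * w * (W / (r ^ N * w)) ^ q ≤ ∫ x in s, u x ^ q :=
    mul_div_rpow_le_setIntegral_rpow hu hu0 hq hM hs (isBounded_closedBall.subset hsr)
      ((measureReal_mono hsr measure_closedBall_lt_top.ne).trans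
        (volume_real_closedBall hr.le).le)
  have h4 : c * (2 ^ (-θ) * r ^ (-θ)) ≤ Ψ (2 * r) := by
    rw [← Real.mul_rpow two_pos.le hr.le, Real.rpow_neg (by positivity),
      ← div_eq_mul_inv, div_le_iff₀ (by positivity), mul_comm]
    exact hcr
  rw [mul_div_pow_mul_rpow hr hw hV0] at h2
  rw [mul_div_pow_mul_rpow hr hw hW0] at h3
  rw [mul_inv_pow_rpow hr hV0, mul_inv_pow_rpow hr hW0]
  have h5 : r ^ (-θ) * r ^ ((N : ℝ) * (1 - p)) * r ^ ((N : ℝ) * (1 - q))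
      = r ^ (-(((2 * m : ℕ) : ℝ) * p)) * r ^ (-(((2 * m : ℕ) : ℝ) * q)) := by
    rw [← Real.rpow_add hr, ← Real.rpow_add hr, ← Real.rpow_add hr]
    congr 1
    rw [hθ]
    push_cast
    ring
  refine le_trans ?_ h1
  calc _ = c * (2 ^ (-θ)) * w ^ (1 - p) * w ^ (1 - q) * V ^ p * W ^ q
        * (r ^ (-(((2 * m : ℕ) : ℝ) * p)) * r ^ (-(((2 * m : ℕ) : ℝ) * q))) := by ring
    _ = c * (2 ^ (-θ) * r ^ (-θ)) * (V ^ p * (r ^ ((N : ℝ) * (1 - p)) * w ^ (1 - p)))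
        * (W ^ q * (r ^ ((N : ℝ) * (1 - q)) * w ^ (1 - q))) := by
        rw [← h5]
        ring
    _ ≤ _ := by
        have := setIntegral_nonneg (μ := volume)
          (measurableSet_closedBall (x := (0 : EuclideanSpace ℝ (Fin N))) (ε := r))
          fun x _ => Real.rpow_nonneg (hv0 x) p
        gcongr

lemma false_of_interaction_bounds {F G U V : ℝ → ℝ} {k : ℕ} (hk : 1 ≤ k)
    {C κ κ' c₀ r₁ p q p' q' : ℝ}
    (hC : 0 < C) (hκ : 0 < κ) (hκ' : 0 < κ') (hc₀ : 0 < c₀) (hp : 1 ≤ p) (hq : 1 ≤ q)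
    (hp' : 1 ≤ p') (hq' : 1 ≤ q') (hF : Monotone F)
    (hFU : ∀ r, 0 < r → F r ≤ C * (U r * (r ^ k)⁻¹))
    (hGV : ∀ r, 0 < r → G r ≤ C * (V r * (r ^ k)⁻¹))
    (hF1 : ∀ r, r₁ ≤ r → c₀ ≤ F r) (hG1 : ∀ r, r₁ ≤ r → c₀ ≤ G r)
    {P : ℝ → Prop} (hP : ∃ᶠ r in atTop, P r)
    (hPF : ∀ r, 0 < r → P r → ∀ T ≤ r,
      κ * (V r * (r ^ k)⁻¹) ^ p * ((U r - U T) * (r ^ k)⁻¹) ^ q ≤ F r - F T)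
    (hPG : ∀ r, 0 < r → P r → κ' * (U r * (r ^ k)⁻¹) ^ p' * (V r * (r ^ k)⁻¹) ^ q' ≤ G r) :
    False := by
  set c₁ := c₀ / C with hc₁
  have hc₁0 : 0 < c₁ := by positivity
  have ha : ∀ r, 0 < r → r₁ ≤ r → c₁ ≤ U r * (r ^ k)⁻¹ := fun r h0 h1 => by
    rw [hc₁, div_le_iff₀ hC, mul_comm]
    exact (hF1 r h1).trans (hFU r h0)
  have hb : ∀ r, 0 < r → r₁ ≤ r → c₁ ≤ V r * (r ^ k)⁻¹ := fun r h0 h1 => by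
    rw [hc₁, div_le_iff₀ hC, mul_comm]
    exact (hG1 r h1).trans (hGV r h0)
  set A := max 1 (C / (κ' * c₁ ^ (q' - 1))) with hA
  have hbound : ∀ r, F r ≤ C * A := fun r => by
    obtain ⟨s, hPs, hs0, hs1, hrs⟩ := (hP.and_eventually ((eventually_gt_atTop 0).and
      ((eventually_ge_atTop r₁).and (eventually_ge_atTop r)))).exists
    refine (hF hrs).trans ((hFU s hs0).trans (mul_le_mul_of_nonneg_left ?_ hC.le))
    have h1 := hPG s hs0 hPs
    have h2 := hGV s hs0
    have h3 := ha s hs0 hs1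
    have h4 := hb s hs0 hs1
    set a := U s * (s ^ k)⁻¹
    set b := V s * (s ^ k)⁻¹
    have hb0 : 0 < b := hc₁0.trans_le h4
    have ha0 : 0 < a := hc₁0.trans_le h3
    have h5 : c₁ ^ (q' - 1) * b ≤ b ^ q' := by
      have h : b ^ q' = b ^ (q' - 1) * b := by
        rw [Real.rpow_sub_one hb0.ne']
        field_simp
      rw [h]
      gcongr
    rcases le_or_gt a 1 with h | h
    · exact h.trans (le_max_left _ _)
    · refine le_trans ?_ (le_max_right _ _)
      have h6 : a ≤ a ^ p' := Real.self_le_rpow_of_one_le h.le hp'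
      rw [le_div_iff₀ (by positivity)]
      have h7 : κ' * a * (c₁ ^ (q' - 1) * b) ≤ C * b := by
        refine le_trans ?_ (h1.trans h2)
        gcongr
      nlinarith
  have hbdd : BddAbove (Set.range F) := ⟨C * A, by rintro _ ⟨r, rfl⟩; exact hbound r⟩
  set δ := κ * c₁ ^ p * (c₁ / 2) ^ q with hδ
  have hδ0 : 0 < δ := by positivity
  obtain ⟨T, hT⟩ := exists_lt_of_lt_ciSup (show iSup F - δ < iSup F by linarith)
  have hlim : Tendsto (fun r : ℝ => U T * (r ^ k)⁻¹) atTop (nhds (U T * 0)) :=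
    (tendsto_inv_atTop_zero.comp (tendsto_pow_atTop (by omega))).const_mul _
  rw [mul_zero] at hlim
  obtain ⟨r, hPr, hr0, hr1, hTr, hU⟩ := (hP.and_eventually ((eventually_gt_atTop 0).and
      ((eventually_ge_atTop r₁).and ((eventually_ge_atTop T).and
        (hlim.eventually_lt_const (show 0 < c₁ / 2 by positivity)))))).exists
  have h1 := hPF r hr0 hPr T hTr
  have h2 : c₁ / 2 ≤ (U r - U T) * (r ^ k)⁻¹ := by
    rw [sub_mul]
    linarith [ha r hr0 hr1]
  have h3 : δ ≤ κ * (V r * (r ^ k)⁻¹) ^ p * ((U r - U T) * (r ^ k)⁻¹) ^ q := by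
    rw [hδ]
    have h4 := hb r hr0 hr1
    have := hc₁0.trans_le h4
    gcongr
  linarith [le_ciSup hbdd r]

lemma exists_pos_le_setIntegral_closedBall [NeZero N] {Ψ : ℝ → ℝ} (hK : CondK N Ψ) {p q : ℝ}
    (hp : 1 ≤ p) {u v f : EuclideanSpace ℝ (Fin N) → ℝ}
    (hv : Continuous v) (hf : Continuous f) (hu0 : ∀ x, 0 ≤ u x) (hv0 : ∀ x, 0 ≤ v x)
    (hf0 : ∀ x, 0 ≤ f x)
    (hint : IntegrableOn (fun y : EuclideanSpace ℝ (Fin N) => v y ^ p * Ψ (‖y‖ / 2))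
      {y | 1 < ‖y‖})
    (hle : ∀ x, (∫ y, v y ^ p * Ψ ‖y - x‖) * u x ^ q ≤ f x)
    (hu : ¬ ∀ x, u x = 0) (hvne : ¬ ∀ x, v x = 0) :
    ∃ c₀ r₁, 0 < c₀ ∧ ∀ r, r₁ ≤ r → c₀ ≤ ∫ x in closedBall 0 r, f x := by
  push Not at hu hvne
  obtain ⟨x, hx⟩ := hu
  obtain ⟨y, hy⟩ := hvne
  have hux : 0 < u x := (hu0 x).lt_of_ne' hx
  have hvy : 0 < v y := (hv0 y).lt_of_ne' hy
  have hvp : Continuous fun y => v y ^ p := hv.rpow_const fun _ => Or.inr (by linarith)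
  set s := ‖x‖ + ‖y‖ + 1 with hs
  have hs0 : 0 < s := by positivity
  have h1 : 0 < ∫ y in closedBall 0 s, v y ^ p :=
    setIntegral_closedBall_pos hvp (fun z => Real.rpow_nonneg (hv0 z) p)
      (Real.rpow_pos_of_pos hvy p) (by linarith [norm_nonneg x])
  have h2 : 0 < ∫ y, v y ^ p * Ψ ‖y - x‖ := by
    refine (mul_pos (hK.pos (2 * s) (by linarith)) h1).trans_le
      (kernel_mul_setIntegral_le hK hp hv hv0 hint ?_ hs0)
    simp only [mem_closedBall, dist_zero_right]
    linarith [norm_nonneg y]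
  have h3 : 0 < f x := (mul_pos h2 (Real.rpow_pos_of_pos hux q)).trans_le (hle x)
  refine ⟨_, s, setIntegral_closedBall_pos hf hf0 h3 (r := s) (by linarith [norm_nonneg y]),
    fun r hr => ?_⟩
  exact setIntegral_mono_set (hf.integrableOn_closedBall 0 r) (Eventually.of_forall hf0)
    (closedBall_subset_closedBall hr).eventuallyLE

lemma eq_zero_or_eq_zero_of_interaction (m : ℕ) (hm : 1 ≤ m) (hN : 2 * m < N)
    {Ψ Ψ' Φ Φ' : ℝ → ℝ} (hK : CondK N Ψ) (hK' : CondK N Ψ') (hΦ : CondK N Φ) (hΦ' : CondK N Φ')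
    {p q p' q' s s' : ℝ} (hp : 1 ≤ p) (hq : 1 ≤ q) (hp' : 1 ≤ p') (hq' : 1 ≤ q') (hs : 1 ≤ s)
    (hs' : 1 ≤ s') {u v : EuclideanSpace ℝ (Fin N) → ℝ}
    (hu : ContDiff ℝ (2 * m) u) (hv : ContDiff ℝ (2 * m) v)
    (hu0 : ∀ x, 0 ≤ u x) (hv0 : ∀ x, 0 ≤ v x)
    (hus : IntegrableOn (fun y : EuclideanSpace ℝ (Fin N) => u y ^ s * Φ (‖y‖ / 2))
      {y | 1 < ‖y‖})
    (hvs : IntegrableOn (fun y : EuclideanSpace ℝ (Fin N) => v y ^ s' * Φ' (‖y‖ / 2))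
      {y | 1 < ‖y‖})
    (hvp : IntegrableOn (fun y : EuclideanSpace ℝ (Fin N) => v y ^ p * Ψ (‖y‖ / 2))
      {y | 1 < ‖y‖})
    (hup : IntegrableOn (fun y : EuclideanSpace ℝ (Fin N) => u y ^ p' * Ψ' (‖y‖ / 2))
      {y | 1 < ‖y‖})
    (hLu : ∀ x, (∫ y, v y ^ p * Ψ ‖y - x‖) * u x ^ q ≤ negLapPow m u x)
    (hLv : ∀ x, (∫ y, u y ^ p' * Ψ' ‖y - x‖) * v x ^ q' ≤ negLapPow m v x)
    {c : ℝ} (hc : 0 < c)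
    (hfreq : ∃ᶠ r : ℝ in atTop,
      c ≤ min (r ^ (2 * (N : ℝ) - ((N : ℝ) - 2 * m) * (p + q)) * Ψ r)
              (r ^ (2 * (N : ℝ) - ((N : ℝ) - 2 * m) * (p' + q')) * Ψ' r)) :
    (∀ x, u x = 0) ∨ (∀ x, v x = 0) := by
  have : NeZero N := ⟨by omega⟩
  by_contra! h
  obtain ⟨hune, hvne⟩ := h
  have hune' : ¬ ∀ x, u x = 0 := by simpa using hune
  have hvne' : ¬ ∀ x, v x = 0 := by simpa using hvne
  set f := negLapPow m u with hf_def
  set g := negLapPow m v with hg_def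
  have hf : Continuous f := (contDiff_negLapPow (k := 0) m hu (by simp)).continuous
  have hg : Continuous g := (contDiff_negLapPow (k := 0) m hv (by simp)).continuous
  have hf0 : ∀ x, 0 ≤ f x := fun x => (mul_nonneg (integral_nonneg_of_ae
    (ae_rpow_mul_kernel_nonneg hK p hv0 x)) (Real.rpow_nonneg (hu0 x) q)).trans (hLu x)
  have hg0 : ∀ x, 0 ≤ g x := fun x => (mul_nonneg (integral_nonneg_of_ae
    (ae_rpow_mul_kernel_nonneg hK' p' hu0 x)) (Real.rpow_nonneg (hv0 x) q')).trans (hLv x)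
  obtain ⟨C, hC, hCle⟩ := setIntegral_negLapPow_le N m hm hN
  obtain ⟨κ, hκ, hκle⟩ := exists_interaction_lower_bound hK hp hq hu.continuous hv.continuous hf
    hu0 hv0 hvp hLu m hc
  obtain ⟨κ', hκ', hκ'le⟩ := exists_interaction_lower_bound hK' hp' hq' hv.continuous
    hu.continuous hg hv0 hu0 hup hLv m hc
  obtain ⟨c₀, r₀, hc₀, hF⟩ := exists_pos_le_setIntegral_closedBall hK hp hv.continuous hf hu0 hv0
    hf0 hvp hLu hune' hvne'
  obtain ⟨c₁, r₁, hc₁, hG⟩ := exists_pos_le_setIntegral_closedBall hK' hp' hu.continuous hg hv0 hu0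
    hg0 hup hLv hvne' hune'
  have hfreq' : ∃ᶠ r : ℝ in atTop,
      c ≤ min ((2 * r) ^ (2 * (N : ℝ) - ((N : ℝ) - 2 * m) * (p + q)) * Ψ (2 * r))
        ((2 * r) ^ (2 * (N : ℝ) - ((N : ℝ) - 2 * m) * (p' + q')) * Ψ' (2 * r)) := by
    have ht : Tendsto (fun r : ℝ => r / 2) atTop atTop :=
      tendsto_id.atTop_div_const (by norm_num)
    refine ht.frequently (hfreq.mono fun r hr => ?_)
    rwa [mul_div_cancel₀ r two_ne_zero]
  refine false_of_interaction_bounds (k := 2 * m) (by omega) hC hκ hκ' (lt_min hc₀ hc₁) hp hq hp'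
    hq'
    (F := fun r => ∫ x in closedBall 0 r, f x) (G := fun r => ∫ x in closedBall 0 r, g x)
    (U := fun r => ∫ x in closedBall 0 r, u x) (V := fun r => ∫ x in closedBall 0 r, v x)
    (r₁ := max r₀ r₁) ?_ ?_ ?_ (fun r hr => (min_le_left _ _).trans (hF r (le_of_max_le_left hr)))
    (fun r hr => (min_le_right _ _).trans (hG r (le_of_max_le_right hr))) hfreq'
    (fun r hr hPr T hT => hκle r hr T hT (le_min_iff.1 hPr).1) fun r hr hPr => ?_
  · exact fun r r' hr => setIntegral_mono_set (hf.integrableOn_closedBall 0 r')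
      (Eventually.of_forall hf0) (closedBall_subset_closedBall hr).eventuallyLE
  · intro r hr
    rw [mul_comm (∫ x in closedBall 0 r, u x)]
    exact hCle u hu hu0 hf0 (exists_setIntegral_closedBall_le hΦ hs hu.continuous hu0 hus) r hr
  · intro r hr
    rw [mul_comm (∫ x in closedBall 0 r, v x)]
    exact hCle v hv hv0 hg0 (exists_setIntegral_closedBall_le hΦ' hs' hv.continuous hv0 hvs) r hr
  · have h := hκ'le r hr (-1) (by linarith) (le_min_iff.1 hPr).2
    rwa [closedBall_eq_empty.2 (by norm_num : (-1 : ℝ) < 0), setIntegral_empty, setIntegral_empty,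
      sub_zero, sub_zero] at h

end

theorem stmt_9 (N m : ℕ) (hm : 1 ≤ m) (hN : 2 * m < N)
    (n : ℕ) (hn : 1 ≤ n)
    (e : Fin n → Fin n → ℝ)
    (he01 : ∀ i j, e i j = 0 ∨ e i j = 1)
    (hesymm : ∀ i j, e i j = e j i)
    (p q : Fin n → Fin n → ℝ)
    (hp : ∀ i j, 1 ≤ p i j) (hq : ∀ i j, 0 < q i j)
    (Ψ : Fin n → Fin n → ℝ → ℝ) (hK : ∀ i j, CondK N (Ψ i j))
    (u : Fin n → EuclideanSpace ℝ (Fin N) → ℝ)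
    (hreg : ∀ j, ContDiff ℝ (2 * m) (u j))
    (hpos : ∀ j x, 0 ≤ u j x)
    (hint : ∀ i j, IntegrableOn
      (fun y : EuclideanSpace ℝ (Fin N) => u j y ^ p i j * Ψ i j (‖y‖ / 2))
      {y : EuclideanSpace ℝ (Fin N) | 1 < ‖y‖})
    (hineq : ∀ i, ∀ x : EuclideanSpace ℝ (Fin N),
      (∑ j, e i j * ((∫ y : EuclideanSpace ℝ (Fin N), u j y ^ p i j * Ψ i j ‖y - x‖)
        * u i x ^ q i j)) ≤ negLapPow m (u i) x)
    (k l : Fin n) (hekl : e k l = 1) (helk : e l k = 1)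
    (hpkl : 1 ≤ p k l) (hqkl : 1 ≤ q k l) (hplk : 1 ≤ p l k) (hqlk : 1 ≤ q l k)
    (hlimsup : ∃ c : ℝ, 0 < c ∧ ∃ᶠ r : ℝ in atTop,
      c ≤ min (r ^ (2 * (N : ℝ) - ((N : ℝ) - 2 * m) * (p k l + q k l)) * Ψ k l r)
              (r ^ (2 * (N : ℝ) - ((N : ℝ) - 2 * m) * (p l k + q l k)) * Ψ l k r)) :
    (∀ x, u k x = 0) ∨ (∀ x, u l x = 0) := by
  have : NeZero N := ⟨by omega⟩
  have hterm : ∀ i j x, 0 ≤ e i j * ((∫ y : EuclideanSpace ℝ (Fin N),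
      u j y ^ p i j * Ψ i j ‖y - x‖) * u i x ^ q i j) := fun i j x => by
    refine mul_nonneg ?_ (mul_nonneg (integral_nonneg_of_ae
      (ae_rpow_mul_kernel_nonneg (hK i j) _ (hpos j) x)) (Real.rpow_nonneg (hpos i x) _))
    rcases he01 i j with h | h <;> simp [h]
  have hle : ∀ i j, e i j = 1 → ∀ x, (∫ y : EuclideanSpace ℝ (Fin N),
      u j y ^ p i j * Ψ i j ‖y - x‖) * u i x ^ q i j ≤ negLapPow m (u i) x := fun i j hij x => by
    have h := (Finset.single_le_sum (fun j _ => hterm i j x) (Finset.mem_univ j)).trans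
      (hineq i x)
    rwa [hij, one_mul] at h
  obtain ⟨c, hc, hfreq⟩ := hlimsup
  exact eq_zero_or_eq_zero_of_interaction m hm hN (hK k l) (hK l k) (hK k k) (hK l l) hpkl hqkl
    hplk hqlk (hp k k) (hp l l) (hreg k) (hreg l) (hpos k) (hpos l) (hint k k) (hint l l)
    (hint k l) (hint l k) (hle k l hekl) (hle l k helk) hc hfreq
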